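/- Let n ≥ 1 and let w : Finset (Fin n) → ℝⁿ be a realized oriented cube. Then the oriented matroid of affine dependencies of w is isomorphic to that of the standard real cube: there exists a bijection σ : Finset (Fin n) ≃ Finset (Fin n) such that for every sign vector X : Finset (Fin n) → SignType the following are equivalent: (1) there exists c : Finset (Fin n) → ℝ, c ≠ 0, with ∑_A c A = 0, ∑_A (c A) • (w A) = 0, and SignType.sign (c A) = X A for every A; (2) there exists c' : Finset (Fin n) → ℝ, c' ≠ 0, with ∑_A c' A = 0, ∑_A (c' A) • v_A = 0, and SignType.sign (c' A) = X (σ A) for every A, where v_A is the standard vertex. -/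

import Mathlib

/-- A set `S` of cube-vertex indices spans an affine hyperplane flat of the
configuration `w`: the affine span of `w '' S` has dimension `n - 1` and
contains no other point of the family. -/
def IsHypFlat (n : ℕ) (w : Finset (Fin n) → (Fin n → ℝ)) (S : Set (Finset (Fin n))) : Prop :=
  Module.finrank ℝ (affineSpan ℝ (w '' S)).direction = n - 1 ∧
    Set.range w ∩ (affineSpan ℝ (w '' S) : Set (Fin n → ℝ)) = w '' S

/-- A family `w : Finset (Fin n) → ℝⁿ` is a realized oriented cube. -/
structure IsRealizedCube (n : ℕ) (w : Finset (Fin n) → (Fin n → ℝ)) : Prop where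
  inj : Function.Injective w
  span_top : affineSpan ℝ (Set.range w) = ⊤
  triples : ∀ A B C : Finset (Fin n), A ≠ B → A ≠ C → B ≠ C →
    AffineIndependent ℝ ![w A, w B, w C]
  rect : ∀ D B C : Finset (Fin n), Disjoint B C → B.Nonempty → C.Nonempty →
    (openSegment ℝ (w D) (w (symmDiff D (B ∪ C))) ∩
      openSegment ℝ (w (symmDiff D B)) (w (symmDiff D C))).Nonempty
  facet_pos : ∀ i : Fin n, IsHypFlat n w {A | i ∉ A}
  facet_neg : ∀ i : Fin n, IsHypFlat n w {A | i ∈ A}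
  skew_pos : ∀ i j : Fin n, i ≠ j → IsHypFlat n w {A | i ∈ A ↔ j ∈ A}
  skew_neg : ∀ i j : Fin n, i ≠ j → IsHypFlat n w {A | i ∈ A ↔ j ∉ A}

/-- The standard vertex of the cube indexed by `A`: coordinate `-1` on `A`, `1` off `A`. -/
noncomputable def stdVertex (n : ℕ) (A : Finset (Fin n)) : Fin n → ℝ :=
  fun i => if i ∈ A then -1 else 1

theorem rc_K {n : ℕ} (P : AffineSubspace ℝ (Fin n → ℝ)) (x y p : Fin n → ℝ)
    (hp : p ∈ openSegment ℝ x y) (hpP : p ∈ P) (hx : x ∈ P) : y ∈ P := by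
  obtain ⟨a, b, ha, hb, hab, rfl⟩ := hp
  have := AffineMap.lineMap_mem (b⁻¹) hx hpP
  convert this using 1
  have ha' : a = 1 - b := by linarith
  subst ha'
  ext i
  simp [AffineMap.lineMap_apply]
  field_simp
  ring

theorem rc_K' {n : ℕ} (P : AffineSubspace ℝ (Fin n → ℝ)) (x y p q : Fin n → ℝ)
    (hp : p ∈ openSegment ℝ x y) (hq : q ∈ openSegment ℝ x y) (hne : p ≠ q)
    (hpP : p ∈ P) (hqP : q ∈ P) : x ∈ P := by
  obtain ⟨a, s, ha, hs, hab, rfl⟩ := hp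
  obtain ⟨a', t, ha', ht, hab', rfl⟩ := hq
  have e1 : a = 1 - s := by linarith
  have e2 : a' = 1 - t := by linarith
  subst e1 e2
  have hst : t - s ≠ 0 := by
    intro h
    have : t = s := by linarith
    subst this
    exact hne rfl
  have := AffineMap.lineMap_mem (-s / (t - s)) hpP hqP
  convert this using 1
  ext i
  simp [AffineMap.lineMap_apply]
  field_simp
  ring

theorem rc_cross {n : ℕ} {w : Finset (Fin n) → (Fin n → ℝ)} (hw : IsRealizedCube n w)
    (A B : Finset (Fin n)) (h1 : A ≠ B) (h2 : A ≠ Bᶜ) :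
    ∃ p, p ∈ openSegment ℝ (w A) (w Aᶜ) ∧ p ∈ openSegment ℝ (w B) (w Bᶜ) := by
  have h := hw.rect A (symmDiff A B) (symmDiff A B)ᶜ disjoint_compl_right
    (by
      rw [Finset.nonempty_iff_ne_empty]
      intro h
      exact h1 (symmDiff_eq_bot.1 h))
    (by
      rw [Finset.nonempty_iff_ne_empty]
      intro h
      apply h2
      have h3 : symmDiff A B = Finset.univ := compl_eq_bot.1 h
      ext i
      have := Finset.ext_iff.1 h3 i
      simp [Finset.mem_symmDiff] at this ⊢
      tauto)
  have e1 : symmDiff A (symmDiff A B ∪ (symmDiff A B)ᶜ) = Aᶜ := by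
    rw [Finset.union_compl]; exact symmDiff_top A
  have e2 : symmDiff A (symmDiff A B) = B := symmDiff_symmDiff_cancel_left A B
  have e3 : symmDiff A (symmDiff A B)ᶜ = Bᶜ := by
    ext i; simp [Finset.mem_symmDiff]; tauto
  rw [e1, e2, e3] at h
  obtain ⟨p, hp⟩ := h
  exact ⟨p, hp.1, hp.2⟩

theorem rc_ne_compl {n : ℕ} (hn : 1 ≤ n) (A : Finset (Fin n)) : A ≠ Aᶜ := by
  intro h
  have : (⟨0, hn⟩ : Fin n) ∈ A ↔ (⟨0, hn⟩ : Fin n) ∈ Aᶜ := by rw [← h]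
  simp at this

theorem rc_conc {n : ℕ} (hn : 1 ≤ n) {w : Finset (Fin n) → (Fin n → ℝ)}
    (hw : IsRealizedCube n w) : ∃ o, ∀ A, o ∈ openSegment ℝ (w A) (w Aᶜ) := by
  rcases Nat.lt_or_ge n 2 with h | h2
  · have : n = 1 := by omega
    subst this
    have hA : ∀ A : Finset (Fin 1), A = ∅ ∨ A = ∅ᶜ := by decide
    refine ⟨(1/2 : ℝ) • w ∅ + (1/2 : ℝ) • w ∅ᶜ, fun A => ?_⟩
    have h0 : (1/2 : ℝ) • w ∅ + (1/2 : ℝ) • w ∅ᶜ ∈ openSegment ℝ (w ∅) (w ∅ᶜ) :=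
      ⟨1/2, 1/2, by norm_num, by norm_num, by norm_num, rfl⟩
    rcases hA A with rfl | rfl
    · exact h0
    · rw [openSegment_symm, compl_compl]; exact h0
  rcases Nat.lt_or_ge n 3 with h | h3
  · have : n = 2 := by omega
    subst this
    have hA : ∀ A : Finset (Fin 2), A = ∅ ∨ A = ∅ᶜ ∨ A = {0} ∨ A = {0}ᶜ := by decide
    obtain ⟨o, ho1, ho2⟩ := rc_cross hw ∅ {0} (by decide) (by decide)
    refine ⟨o, fun A => ?_⟩
    rcases hA A with rfl | rfl | rfl | rfl
    · exact ho1
    · rw [openSegment_symm, compl_compl]; exact ho1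
    · exact ho2
    · rw [openSegment_symm, compl_compl]; exact ho2
  let z : Fin n := ⟨0, by omega⟩
  let y : Fin n := ⟨1, by omega⟩
  have hz1 : (∅ : Finset (Fin n)) ≠ {z} := (Finset.singleton_ne_empty z).symm
  have hz2 : (∅ : Finset (Fin n)) ≠ {z}ᶜ := by
    intro h
    have : y ∈ ({z}ᶜ : Finset (Fin n)) := by simp [y, z]
    rw [← h] at this
    simp at this
  obtain ⟨o, ho1, ho2⟩ := rc_cross hw ∅ {z} hz1 hz2
  set P := affineSpan ℝ ({w ∅, w ∅ᶜ, w {z}} : Set (Fin n → ℝ)) with hP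
  have m1 : w ∅ ∈ P := subset_affineSpan ℝ _ (by simp)
  have m2 : w ∅ᶜ ∈ P := subset_affineSpan ℝ _ (by simp)
  have m3 : w {z} ∈ P := subset_affineSpan ℝ _ (by simp)
  have seg : ∀ (x y p : Fin n → ℝ), x ∈ P → y ∈ P → p ∈ openSegment ℝ x y → p ∈ P := by
    intro x y p hx hy hp
    exact P.convex.segment_subset hx hy (openSegment_subset_segment _ _ _ hp)
  have mo : o ∈ P := seg _ _ _ m1 m2 ho1
  have m4 : w {z}ᶜ ∈ P := rc_K P _ _ _ ho2 mo m3
  -- points outside the plane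
  have hout : ∀ B, w B ∉ P → o ∈ openSegment ℝ (w B) (w Bᶜ) := by
    intro B hB
    have b1 : B ≠ ∅ := by rintro rfl; exact hB m1
    have b2 : B ≠ ∅ᶜ := by rintro rfl; exact hB m2
    have b3 : B ≠ {z} := by rintro rfl; exact hB m3
    have b4 : B ≠ {z}ᶜ := by rintro rfl; exact hB m4
    obtain ⟨p, hp, hp'⟩ := rc_cross hw B ∅ b1 b2
    obtain ⟨q, hq, hq'⟩ := rc_cross hw B {z} b3 b4
    have pP := seg _ _ _ m1 m2 hp'
    have qP := seg _ _ _ m3 m4 hq'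
    have pq : p = q := by
      by_contra hne
      exact hB (rc_K' P _ _ _ _ hp hq hne pP qP)
    subst pq
    have po : p = o := by
      by_contra hne
      -- then w ∅ is on the line {z}
      let Q := affineSpan ℝ ({w {z}, w {z}ᶜ} : Set (Fin n → ℝ))
      have q1 : w {z} ∈ Q := subset_affineSpan ℝ _ (by simp)
      have q2 : w {z}ᶜ ∈ Q := subset_affineSpan ℝ _ (by simp)
      have q3 : p ∈ Q := Q.convex.segment_subset q1 q2 (openSegment_subset_segment _ _ _ hq')
      have q4 : o ∈ Q := Q.convex.segment_subset q1 q2 (openSegment_subset_segment _ _ _ ho2)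
      have q5 : w ∅ ∈ Q := rc_K' Q _ _ _ _ hp' ho1 hne q3 q4
      have ht := hw.triples ∅ {z} {z}ᶜ hz1 hz2 (rc_ne_compl hn _)
      have hc : Collinear ℝ ({w ∅, w {z}, w {z}ᶜ} : Set (Fin n → ℝ)) :=
        collinear_insert_of_mem_affineSpan_pair q5
      exact (affineIndependent_iff_not_collinear_set.1 ht) hc
    exact po ▸ hp
  obtain ⟨B, hB⟩ : ∃ B, w B ∉ P := by
    by_contra! hall
    have hle : affineSpan ℝ (Set.range w) ≤ P := by
      rw [affineSpan_le]
      rintro _ ⟨A, rfl⟩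
      exact hall A
    rw [hw.span_top, top_le_iff] at hle
    have hd : P.direction = ⊤ := by rw [hle]; exact AffineSubspace.direction_top _ _ _
    have hf : Module.finrank ℝ P.direction = n := by rw [hd]; simp
    have hr : Module.finrank ℝ (vectorSpan ℝ (Set.range ![w ∅, w ∅ᶜ, w {z}])) ≤ 2 :=
      finrank_vectorSpan_range_le ℝ _ (by simp)
    rw [hP, direction_affineSpan] at hf
    have : Set.range ![w ∅, w ∅ᶜ, w {z}] = {w ∅, w ∅ᶜ, w {z}} := by
      simp [Matrix.range_cons]
      ext; simp; tauto
    rw [this, hf] at hr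
    omega
  refine ⟨o, fun A => ?_⟩
  by_cases hA : w A ∈ P
  swap
  · exact hout A hA
  by_cases hAB : A = Bᶜ
  · subst hAB
    rw [openSegment_symm, compl_compl]; exact hout B hB
  have hAB' : A ≠ B := by rintro rfl; exact hB hA
  have hAc : w Aᶜ ∈ P := by
    by_cases a1 : A = ∅
    · subst a1; exact m2
    by_cases a2 : A = ∅ᶜ
    · subst a2; rw [compl_compl]; exact m1
    obtain ⟨p, hp, hp'⟩ := rc_cross hw A ∅ a1 a2
    exact rc_K P _ _ _ hp (seg _ _ _ m1 m2 hp') hA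
  obtain ⟨p, hp, hp'⟩ := rc_cross hw A B hAB' hAB
  have : p = o := by
    by_contra hne
    exact hB (rc_K' P _ _ _ _ hp' (hout B hB) hne (seg _ _ _ hA hAc hp) mo)
  exact this ▸ hp

/-- vectors -/
theorem rc_indep {n : ℕ} {w : Finset (Fin n) → (Fin n → ℝ)} (hw : IsRealizedCube n w)
    (α : Finset (Fin n) → ℝ) (hα : ∀ A, 0 < α A) (O : ℝ × (Fin n → ℝ))
    (hO : ∀ A, α A • ((1 : ℝ), w A) + α Aᶜ • ((1 : ℝ), w Aᶜ) = O)
    (D B C : Finset (Fin n)) (hBC : Disjoint B C) (hB : B.Nonempty) (hC : C.Nonempty)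
    (hE : B ∪ C ≠ Finset.univ) (c0 c1 c2 c3 : ℝ)
    (h : c0 • O + c1 • α D • ((1 : ℝ), w D)
      + c2 • α (symmDiff D B) • ((1 : ℝ), w (symmDiff D B))
      + c3 • α (symmDiff D C) • ((1 : ℝ), w (symmDiff D C)) = 0) :
    c0 = 0 ∧ c1 = 0 ∧ c2 = 0 ∧ c3 = 0 := by
  obtain ⟨i, hi⟩ : ∃ i, i ∉ B ∪ C := by
    by_contra! hh
    exact hE (Finset.eq_univ_iff_forall.2 hh)
  have hiB : i ∉ B := fun h => hi (Finset.mem_union_left _ h)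
  have hiC : i ∉ C := fun h => hi (Finset.mem_union_right _ h)
  obtain ⟨b, hb⟩ := hB
  obtain ⟨c, hc⟩ := hC
  have hbC : b ∉ C := Finset.disjoint_left.1 hBC hb
  have n1 : D ≠ symmDiff D B := by
    intro h; have := Finset.ext_iff.1 h b; simp [Finset.mem_symmDiff, hb] at this
  have n2 : D ≠ symmDiff D C := by
    intro h; have := Finset.ext_iff.1 h c; simp [Finset.mem_symmDiff, hc] at this
  have n3 : symmDiff D B ≠ symmDiff D C := by
    intro h; have := Finset.ext_iff.1 h b; simp [Finset.mem_symmDiff, hb, hbC] at this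
  -- the facet
  obtain ⟨S, hS, s1, s2, s3, s4⟩ : ∃ S : Set (Finset (Fin n)), IsHypFlat n w S ∧ D ∈ S ∧
      symmDiff D B ∈ S ∧ symmDiff D C ∈ S ∧ Dᶜ ∉ S := by
    by_cases hD : i ∈ D
    · exact ⟨_, hw.facet_neg i, hD, by simp [Finset.mem_symmDiff, hD, hiB],
        by simp [Finset.mem_symmDiff, hD, hiC], by simp [hD]⟩
    · exact ⟨_, hw.facet_pos i, hD, by simp [Finset.mem_symmDiff, hD, hiB],
        by simp [Finset.mem_symmDiff, hD, hiC], by simp [hD]⟩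
  have hnot : w Dᶜ ∉ affineSpan ℝ (w '' S) := by
    intro hm
    have : w Dᶜ ∈ w '' S := by rw [← hS.2]; exact ⟨⟨_, rfl⟩, hm⟩
    obtain ⟨A, hA, hAe⟩ := this
    exact s4 (hw.inj hAe ▸ hA)
  have t := hw.triples _ _ _ n1 n2 n3
  have p0 := hα Dᶜ
  have p1 := hα D
  have p2 := hα (symmDiff D B)
  have p3 := hα (symmDiff D C)
  have a1 : w D ∈ affineSpan ℝ (w '' S) := subset_affineSpan ℝ _ ⟨_, s1, rfl⟩
  have a2 : w (symmDiff D B) ∈ affineSpan ℝ (w '' S) := subset_affineSpan ℝ _ ⟨_, s2, rfl⟩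
  have a3 : w (symmDiff D C) ∈ affineSpan ℝ (w '' S) := subset_affineSpan ℝ _ ⟨_, s3, rfl⟩
  rw [← hO D] at h
  generalize w (symmDiff D B) = u2 at *
  generalize w (symmDiff D C) = u3 at *
  generalize w D = u1 at *
  generalize w Dᶜ = u0 at *
  generalize α (symmDiff D B) = l2 at *
  generalize α (symmDiff D C) = l3 at *
  generalize α D = l1 at *
  generalize α Dᶜ = l0 at *
  have e1 := congrArg Prod.fst h
  have e2 := congrArg Prod.snd h
  simp at e1 e2
  have hc0 : c0 = 0 := by
    by_contra hne
    apply hnot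
    have m1 := AffineSubspace.smul_vsub_vadd_mem _ (-(c2 * l2) / (c0 * l0)) a2 a1 a1
    have m2 := AffineSubspace.smul_vsub_vadd_mem _ (-(c3 * l3) / (c0 * l0)) a3 a1 m1
    convert m2 using 1
    ext j
    have := congrFun e2 j
    simp at this ⊢
    have hl : c0 * l0 ≠ 0 := mul_ne_zero hne p0.ne'
    field_simp
    linear_combination this - u1 j * e1
  subst hc0
  rw [affineIndependent_iff] at t
  have := t Finset.univ ![c1 * l1, c2 * l2, c3 * l3]
    (by simp [Fin.sum_univ_three]; linarith)
    (by simpa [Fin.sum_univ_three, mul_smul] using e2)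
  have t1 := this 0 (by simp)
  have t2 := this 1 (by simp)
  have t3 := this 2 (by simp)
  simp [p1.ne', p2.ne', p3.ne'] at t1 t2 t3
  exact ⟨rfl, t1, t2, t3⟩

theorem rc_rel {n : ℕ} {w : Finset (Fin n) → (Fin n → ℝ)} (hw : IsRealizedCube n w)
    (α : Finset (Fin n) → ℝ) (hα : ∀ A, 0 < α A)
    (D B C : Finset (Fin n)) (hBC : Disjoint B C) (hB : B.Nonempty) (hC : C.Nonempty) :
    ∃ a b c d : ℝ, 0 < a ∧ 0 < b ∧ 0 < c ∧ 0 < d ∧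
      a • α D • ((1 : ℝ), w D)
        + b • α (symmDiff D (B ∪ C)) • ((1 : ℝ), w (symmDiff D (B ∪ C)))
      = c • α (symmDiff D B) • ((1 : ℝ), w (symmDiff D B))
        + d • α (symmDiff D C) • ((1 : ℝ), w (symmDiff D C)) := by
  obtain ⟨p, ⟨a, b, ha, hb, hab, h1⟩, ⟨c, d, hc, hd, hcd, h2⟩⟩ := hw.rect D B C hBC hB hC
  have p0 := hα D
  have p1 := hα (symmDiff D (B ∪ C))
  have p2 := hα (symmDiff D B)
  have p3 := hα (symmDiff D C)
  refine ⟨a / α D, b / α (symmDiff D (B ∪ C)), c / α (symmDiff D B), d / α (symmDiff D C),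
    by positivity, by positivity, by positivity, by positivity, ?_⟩
  simp only [smul_smul, div_mul_cancel₀ _ p0.ne', div_mul_cancel₀ _ p1.ne',
    div_mul_cancel₀ _ p2.ne', div_mul_cancel₀ _ p3.ne']
  ext1
  · simp; linarith
  · simp [h1, h2]

theorem rc_rect {n : ℕ} {w : Finset (Fin n) → (Fin n → ℝ)} (hw : IsRealizedCube n w)
    (α : Finset (Fin n) → ℝ) (hα : ∀ A, 0 < α A) (O : ℝ × (Fin n → ℝ))
    (x : Finset (Fin n) → ℝ × (Fin n → ℝ)) (hx : ∀ A, x A = α A • ((1 : ℝ), w A))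
    (hO : ∀ A, x A + x Aᶜ = O)
    (D B C : Finset (Fin n)) (hBC : Disjoint B C) (hB : B.Nonempty) (hC : C.Nonempty) :
    x D + x (symmDiff D (B ∪ C)) = x (symmDiff D B) + x (symmDiff D C) := by
  by_cases hE : B ∪ C = Finset.univ
  · have e1 : symmDiff D (B ∪ C) = Dᶜ := by rw [hE]; exact symmDiff_top D
    have e2 : symmDiff D C = (symmDiff D B)ᶜ := by
      have hCB : C = Bᶜ := by
        ext i
        have h1 : i ∈ B ∪ C := by rw [hE]; simp
        have h2 := (fun h => Finset.disjoint_left.1 hBC h : i ∈ B → i ∉ C)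
        simp at h1 ⊢; tauto
      rw [hCB]; ext i; simp [Finset.mem_symmDiff]; tauto
    rw [e1, e2, hO, hO]
  have ind : ∀ c0 c1 c2 c3 : ℝ, c0 • O + c1 • x D + c2 • x (symmDiff D B)
      + c3 • x (symmDiff D C) = 0 → c0 = 0 ∧ c1 = 0 ∧ c2 = 0 ∧ c3 = 0 := by
    intro c0 c1 c2 c3 h
    simp only [hx] at h
    exact rc_indep hw α hα O (fun A => by rw [← hx, ← hx, hO]) D B C hBC hB hC hE c0 c1 c2 c3 h
  have rel : ∀ D B C : Finset (Fin n), Disjoint B C → B.Nonempty → C.Nonempty →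
      ∃ a b c d : ℝ, 0 < a ∧ 0 < b ∧ 0 < c ∧ 0 < d ∧
      a • x D + b • x (symmDiff D (B ∪ C)) = c • x (symmDiff D B) + d • x (symmDiff D C) := by
    intro D B C h1 h2 h3
    simp only [hx]
    exact rc_rel hw α hα D B C h1 h2 h3
  have hO' : ∀ A, x Aᶜ = O - x A := fun A => by rw [← hO A]; abel
  set E := (B ∪ C)ᶜ with hEdef
  have hEne : E.Nonempty := by
    rw [Finset.nonempty_iff_ne_empty]
    intro h
    apply hE
    exact compl_eq_bot.1 h
  have hBE : Disjoint B E :=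
    Finset.disjoint_left.2 (fun i hi => by simp [hEdef, hi])
  have hCE : Disjoint C E :=
    Finset.disjoint_left.2 (fun i hi => by simp [hEdef, hi])
  have k1 : symmDiff D (B ∪ C) = (symmDiff D E)ᶜ := by
    ext i; simp [hEdef, Finset.mem_symmDiff]; tauto
  have k2 : symmDiff D (B ∪ E) = (symmDiff D C)ᶜ := by
    ext i
    have := (fun h => Finset.disjoint_left.1 hBC h : i ∈ B → i ∉ C)
    simp [hEdef, Finset.mem_symmDiff]; tauto
  have k3 : symmDiff D (C ∪ E) = (symmDiff D B)ᶜ := by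
    ext i
    have := (fun h => Finset.disjoint_left.1 hBC h : i ∈ B → i ∉ C)
    simp [hEdef, Finset.mem_symmDiff]; tauto
  have k4 : symmDiff Dᶜ (B ∪ C) = symmDiff D E := by
    ext i; simp [hEdef, Finset.mem_symmDiff]; tauto
  have k5 : symmDiff Dᶜ B = (symmDiff D B)ᶜ := by
    ext i; simp [Finset.mem_symmDiff]; tauto
  have k6 : symmDiff Dᶜ C = (symmDiff D C)ᶜ := by
    ext i; simp [Finset.mem_symmDiff]; tauto
  obtain ⟨a, b, c, d, ha, hb, hc, hd, r1⟩ := rel D B C hBC hB hC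
  obtain ⟨a2, b2, c2, d2, ha2, hb2, hc2, hd2, r2⟩ := rel D B E hBE hB hEne
  obtain ⟨a3, b3, c3, d3, ha3, hb3, hc3, hd3, r3⟩ := rel D C E hCE hC hEne
  obtain ⟨a4, b4, c4, d4, ha4, hb4, hc4, hd4, r4⟩ := rel Dᶜ B C hBC hB hC
  rw [k1, hO'] at r1 ⊢
  rw [k2, hO'] at r2
  rw [k3, hO'] at r3
  rw [k4, k5, k6, hO', hO', hO'] at r4
  generalize x (symmDiff D B) = XB at *
  generalize x (symmDiff D C) = XC at *
  generalize x (symmDiff D E) = XE at *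
  generalize x D = X0 at *
  obtain ⟨f1, f2, f3, f4⟩ := ind (b * b2 - d2 * b) (b * a2 - d2 * a) (d2 * c - b * c2)
    (d2 * d - b * b2) (by linear_combination (norm := module) b • r2 - d2 • r1)
  obtain ⟨g1, g2, g3, g4⟩ := ind (b * b3 - d3 * b) (b * a3 - d3 * a) (d3 * c - b * b3)
    (d3 * d - b * c3) (by linear_combination (norm := module) b • r3 - d3 • r1)
  obtain ⟨h1, h2, h3, h4⟩ := ind (b * a4 + b4 * b - b * c4 - b * d4) (- b * a4 + b4 * a)
    (b * c4 - b4 * c) (b * d4 - b4 * d) (by linear_combination (norm := module) b • r4 + b4 • r1)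
  have q1 : d = b := by
    have : d2 * (d - b) = 0 := by linear_combination f4 + f1
    rcases mul_eq_zero.1 this with h | h <;> linarith
  have q2 : c = b := by
    have : d3 * (c - b) = 0 := by linear_combination g3 + g1
    rcases mul_eq_zero.1 this with h | h <;> linarith
  have q3 : a = b := by
    have : b4 * (a - b) = 0 := by
      subst q1 q2
      linear_combination h1 + h2 + h3 + h4
    rcases mul_eq_zero.1 this with h | h <;> linarith
  subst q1 
  subst q2 
  subst q3
  have : a • (X0 + (O - XE)) = a • (XB + XC) := by rw [smul_add, smul_add]; exact r1
  exact smul_right_injective _ ha.ne' this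

theorem rc_affine {n : ℕ} (x : Finset (Fin n) → ℝ × (Fin n → ℝ))
    (hr : ∀ D B C : Finset (Fin n), Disjoint B C → B.Nonempty → C.Nonempty →
      x D + x (symmDiff D (B ∪ C)) = x (symmDiff D B) + x (symmDiff D C))
    (A : Finset (Fin n)) : x A = x ∅ + ∑ i ∈ A, (x {i} - x ∅) := by
  induction A using Finset.induction_on with
  | empty => simp
  | insert i A hi ih =>
    rw [Finset.sum_insert hi]
    rcases A.eq_empty_or_nonempty with rfl | hA
    · simp
    · have := hr ∅ {i} A (by simpa using hi) (by simp) hA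
      have e : ∀ S : Finset (Fin n), symmDiff ∅ S = S := fun S => bot_symmDiff S
      rw [e, e, e, ← Finset.insert_eq] at this
      have h2 : x (insert i A) = x {i} + x A - x ∅ := by rw [← this]; abel
      rw [h2, ih]; abel

theorem cube_oriented_matroid_iso (n : ℕ) (hn : 1 ≤ n) (w : Finset (Fin n) → (Fin n → ℝ))
    (hw : IsRealizedCube n w) :
    ∃ σ : Finset (Fin n) ≃ Finset (Fin n),
      ∀ X : Finset (Fin n) → SignType,
        (∃ c : Finset (Fin n) → ℝ, c ≠ 0 ∧ (∑ A, c A) = 0 ∧ (∑ A, c A • w A) = 0 ∧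
          ∀ A, SignType.sign (c A) = X A) ↔
        (∃ c' : Finset (Fin n) → ℝ, c' ≠ 0 ∧ (∑ A, c' A) = 0 ∧
          (∑ A, c' A • stdVertex n A) = 0 ∧
          ∀ A, SignType.sign (c' A) = X (σ A)) := by
  obtain ⟨o, ho⟩ := rc_conc hn hw
  choose α β hα hβ hαβ hαo using ho
  have hcompl : ∀ A, β A = α Aᶜ := by
    intro A
    have h1 := hαo A
    have h2 := hαo Aᶜ
    rw [compl_compl] at h2
    have e1 : α A = 1 - β A := by linarith [hαβ A]
    have e2 : β Aᶜ = 1 - α Aᶜ := by linarith [hαβ Aᶜ]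
    rw [e1] at h1
    rw [e2] at h2
    have h3 : (β A - α Aᶜ) • (w Aᶜ - w A) = 0 := by
      linear_combination (norm := module) h1 - h2
    rcases smul_eq_zero.1 h3 with h | h
    · linarith
    · exact absurd (hw.inj (sub_eq_zero.1 h)).symm (rc_ne_compl hn A)
  set x : Finset (Fin n) → ℝ × (Fin n → ℝ) := fun A => α A • ((1 : ℝ), w A) with hx
  have hO : ∀ A, x A + x Aᶜ = (1, o) := by
    intro A
    simp only [hx, ← hcompl]
    ext1
    · simp [hαβ]
    · simp [hαo]
  have hr := rc_rect hw α hα (1, o) x (fun _ => rfl) hO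
  have haff := rc_affine x hr
  let L : (ℝ × (Fin n → ℝ)) →ₗ[ℝ] (ℝ × (Fin n → ℝ)) :=
    { toFun := fun v => v.1 • x ∅ + ∑ i, ((v.1 - v.2 i) / 2) • (x {i} - x ∅)
      map_add' := by
        intro u v
        have : ∀ i, ((u + v).1 - (u + v).2 i) / 2 = (u.1 - u.2 i) / 2 + (v.1 - v.2 i) / 2 := by
          intro i; simp; ring
        simp only [this]
        simp only [add_smul, Finset.sum_add_distrib, Prod.fst_add]
        abel
      map_smul' := by
        intro t v
        have : ∀ i, ((t • v).1 - (t • v).2 i) / 2 = t * ((v.1 - v.2 i) / 2) := by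
          intro i; simp; ring
        simp only [this]
        simp only [mul_smul, ← Finset.smul_sum, Prod.smul_fst, smul_eq_mul,
          RingHom.id_apply, smul_add] }
  have hL : ∀ A, L (1, stdVertex n A) = x A := by
    intro A
    rw [haff A]
    change (1 : ℝ) • x ∅ + ∑ i, ((1 - stdVertex n A i) / 2) • (x {i} - x ∅) = _
    rw [one_smul, ← Finset.sum_filter_add_sum_filter_not Finset.univ (· ∈ A)]
    congr 1
    have z1 : ∑ i ∈ Finset.univ.filter (fun i => i ∉ A),
        ((1 - stdVertex n A i) / 2) • (x {i} - x ∅) = 0 := by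
      apply Finset.sum_eq_zero
      intro i hi
      have : i ∉ A := by simpa using hi
      simp [stdVertex, this]
    rw [z1, add_zero]
    have : Finset.univ.filter (fun i => i ∈ A) = A := by ext; simp
    rw [this]
    apply Finset.sum_congr rfl
    intro i hi
    have : ((1 : ℝ) - -1) / 2 = 1 := by norm_num
    simp [stdVertex, hi, this]
  have hu : ∀ A, ((1 : ℝ), w A) ∈ LinearMap.range L := by
    intro A
    have : ((1 : ℝ), w A) = (α A)⁻¹ • L (1, stdVertex n A) := by
      rw [hL, hx, smul_smul, inv_mul_cancel₀ (hα A).ne', one_smul]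
    rw [this]
    exact Submodule.smul_mem _ _ ⟨_, rfl⟩
  have h1p : ∀ p : Fin n → ℝ, ((1 : ℝ), p) ∈ LinearMap.range L := by
    intro p
    have hp : p ∈ affineSpan ℝ (Set.range w) := by rw [hw.span_top]; trivial
    obtain ⟨c, hc, rfl⟩ := eq_affineCombination_of_mem_affineSpan_of_fintype hp
    rw [Finset.affineCombination_eq_linear_combination _ _ _ hc]
    have : ((1 : ℝ), ∑ A, c A • w A) = ∑ A, c A • ((1 : ℝ), w A) := by
      ext1
      · simp [Prod.fst_sum, hc]
      · simp [Prod.snd_sum]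
    rw [this]
    exact Submodule.sum_mem _ fun A _ => Submodule.smul_mem _ _ (hu A)
  have hsurj : Function.Surjective L := by
    rintro ⟨t, p⟩
    have : ((t, p) : ℝ × (Fin n → ℝ)) = (1, p) + (t - 1) • (1, 0) := by
      ext1 <;> simp
    change _ ∈ LinearMap.range L
    rw [this]
    exact Submodule.add_mem _ (h1p p) (Submodule.smul_mem _ _ (h1p 0))
  have hinj : Function.Injective L := LinearMap.injective_iff_surjective.2 hsurj
  have key : ∀ c : Finset (Fin n) → ℝ, ((∑ A, c A * α A) = 0 ∧ (∑ A, (c A * α A) • w A) = 0) ↔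
      ((∑ A, c A) = 0 ∧ (∑ A, c A • stdVertex n A) = 0) := by
    intro c
    have e1 : ((∑ A, c A * α A, ∑ A, (c A * α A) • w A) : ℝ × (Fin n → ℝ)) =
        L (∑ A, c A, ∑ A, c A • stdVertex n A) := by
      have : ((∑ A, c A, ∑ A, c A • stdVertex n A) : ℝ × (Fin n → ℝ)) =
          ∑ A, c A • ((1 : ℝ), stdVertex n A) := by
        ext1
        · simp [Prod.fst_sum]
        · simp [Prod.snd_sum]
      rw [this, map_sum]
      simp only [map_smul, hL]
      ext1
      · simp [Prod.fst_sum, hx]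
      · simp [Prod.snd_sum, hx, mul_smul]
    have e2 := (map_eq_zero_iff L hinj (x := (∑ A, c A, ∑ A, c A • stdVertex n A)))
    rw [← e1] at e2
    simpa [Prod.ext_iff] using e2
  refine ⟨Equiv.refl _, fun X => ⟨?_, ?_⟩⟩
  · rintro ⟨c, hc0, hc1, hc2, hcX⟩
    have hcα : ∀ A, c A / α A * α A = c A := fun A => div_mul_cancel₀ _ (hα A).ne'
    obtain ⟨k1, k2⟩ := (key (fun A => c A / α A)).1 (by simp only [hcα]; exact ⟨hc1, hc2⟩)
    refine ⟨fun A => c A / α A, ?_, k1, k2, ?_⟩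
    · intro h
      apply hc0
      ext A
      have := congrFun h A
      simpa [(hα A).ne'] using this
    · intro A
      rw [Equiv.refl_apply, ← hcX A, ← hcα A, sign_mul, sign_pos (hα A), mul_one]
  · rintro ⟨c, hc0, hc1, hc2, hcX⟩
    obtain ⟨k1, k2⟩ := (key c).2 ⟨hc1, hc2⟩
    refine ⟨fun A => c A * α A, ?_, k1, k2, ?_⟩
    · intro h
      apply hc0
      ext A
      have := congrFun h A
      simpa [(hα A).ne'] using this
    · intro A
      rw [sign_mul, sign_pos (hα A), mul_one]
      exact hcX A
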